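/- Let (α, β) be a Mannheim couple in which λ is constant, λ·κ(s)·(1 + H(s)²) = 1 on I, H(s) > 0 on I, and B_β(φ(s)) = N(s) for all s ∈ I. Then for all s ∈ I: T_β(φ(s)) = (H(s)·T(s) + B(s))/√(1 + H(s)²) and N_β(φ(s)) = (T(s) − H(s)·B(s))/√(1 + H(s)²). -/

import Mathlib

open Real RealInnerProductSpace

noncomputable section

/-- Euclidean 3-space. -/
abbrev E3 := EuclideanSpace ℝ (Fin 3)

/-- Cross product on `E3 = EuclideanSpace ℝ (Fin 3)`. -/
def cross3 (x y : E3) : E3 :=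
  (EuclideanSpace.equiv (Fin 3) ℝ).symm
    (crossProduct ((EuclideanSpace.equiv (Fin 3) ℝ) x) ((EuclideanSpace.equiv (Fin 3) ℝ) y))

/-- A unit-speed curve `α : I → E³` together with its Frenet apparatus `(T, N, B, κ, τ)`:
`T = α′`, `κ = ‖T′‖ > 0`, `N = T′/κ`, `B = T × N`, and the Frenet equations
`T′ = κN`, `N′ = −κT + τB`, `B′ = −τN` hold on `I`. -/
structure FrenetCurve (I : Set ℝ) where
  α : ℝ → E3
  T : ℝ → E3
  N : ℝ → E3
  B : ℝ → E3
  κ : ℝ → ℝ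
  τ : ℝ → ℝ
  smooth_α : ContDiffOn ℝ (⊤ : ℕ∞) α I
  smooth_T : ContDiffOn ℝ (⊤ : ℕ∞) T I
  smooth_N : ContDiffOn ℝ (⊤ : ℕ∞) N I
  smooth_B : ContDiffOn ℝ (⊤ : ℕ∞) B I
  smooth_κ : ContDiffOn ℝ (⊤ : ℕ∞) κ I
  smooth_τ : ContDiffOn ℝ (⊤ : ℕ∞) τ I
  /-- `T = α′` -/
  deriv_α : ∀ s ∈ I, HasDerivAt α (T s) s
  /-- unit speed -/
  unit_T : ∀ s ∈ I, ‖T s‖ = 1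
  /-- `N` is a unit vector (together with `frenet_T` this says `N = T′/κ`) -/
  unit_N : ∀ s ∈ I, ‖N s‖ = 1
  /-- `κ = ‖T′‖ > 0` -/
  κ_pos : ∀ s ∈ I, 0 < κ s
  /-- Frenet equation `T′ = κ N` -/
  frenet_T : ∀ s ∈ I, HasDerivAt T (κ s • N s) s
  /-- Frenet equation `N′ = −κ T + τ B` -/
  frenet_N : ∀ s ∈ I, HasDerivAt N (-(κ s) • T s + τ s • B s) s
  /-- Frenet equation `B′ = −τ N` -/
  frenet_B : ∀ s ∈ I, HasDerivAt B (-(τ s) • N s) s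
  /-- `B = T × N` -/
  B_def : ∀ s ∈ I, B s = cross3 (T s) (N s)

/-- The harmonic curvature function `H = τ/κ` (Abelian case, where `τ_G = 0`). -/
def FrenetCurve.H {I : Set ℝ} (c : FrenetCurve I) : ℝ → ℝ := fun s => c.τ s / c.κ s

/-- A Mannheim couple `(α, β)`: there are a smooth function `λ = lam : I → ℝ` and a smooth
reparametrization `φ : I → J` with `φ′ = dφ > 0` such that `β (φ s) = α s + lam s • N s` on `I`,
and the principal normal `N` of `α` is parallel to (a scalar multiple of) the binormal `B_β` of
`β` at corresponding points. -/
structure MannheimCouple (I J : Set ℝ) (a : FrenetCurve I) (b : FrenetCurve J) where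
  lam : ℝ → ℝ
  φ : ℝ → ℝ
  /-- the derivative of `φ` -/
  dφ : ℝ → ℝ
  smooth_lam : ContDiffOn ℝ (⊤ : ℕ∞) lam I
  smooth_φ : ContDiffOn ℝ (⊤ : ℕ∞) φ I
  deriv_φ : ∀ s ∈ I, HasDerivAt φ (dφ s) s
  dφ_pos : ∀ s ∈ I, 0 < dφ s
  maps : ∀ s ∈ I, φ s ∈ J
  couple : ∀ s ∈ I, b.α (φ s) = a.α s + lam s • a.N s
  parallel : ∀ s ∈ I, ∃ c : ℝ, a.N s = c • b.B (φ s)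

theorem c3_0 (x y : E3) : cross3 x y 0 = x 1 * y 2 - x 2 * y 1 := by
  simp [cross3, cross_apply]
theorem c3_1 (x y : E3) : cross3 x y 1 = x 2 * y 0 - x 0 * y 2 := by
  simp [cross3, cross_apply]
theorem c3_2 (x y : E3) : cross3 x y 2 = x 0 * y 1 - x 1 * y 0 := by
  simp [cross3, cross_apply]

theorem unit_c {x : E3} (h : ‖x‖ = 1) : x 0 ^ 2 + x 1 ^ 2 + x 2 ^ 2 = 1 := by
  have h2 := EuclideanSpace.norm_sq_eq x
  rw [h] at h2
  simp [Fin.sum_univ_three] at h2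
  linarith

theorem orth_c {x y : E3} (h : inner ℝ x y = 0) : x 0 * y 0 + x 1 * y 1 + x 2 * y 2 = 0 := by
  simp [PiLp.inner_apply, Fin.sum_univ_three] at h
  linarith

theorem cross_cross_self {x y : E3} (hx : ‖x‖ = 1) (h : inner ℝ x y = 0) :
    cross3 (cross3 x y) x = y := by
  have h1 := unit_c hx
  have h2 := orth_c h
  ext i
  fin_cases i
  · simp only [Fin.zero_eta, Fin.mk_one, Fin.reduceFinMk, c3_0, c3_1, c3_2]
    linear_combination y 0 * h1 - x 0 * h2
  · simp only [Fin.zero_eta, Fin.mk_one, Fin.reduceFinMk, c3_0, c3_1, c3_2]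
    linear_combination y 1 * h1 - x 1 * h2
  · simp only [Fin.zero_eta, Fin.mk_one, Fin.reduceFinMk, c3_0, c3_1, c3_2]
    linear_combination y 2 * h1 - x 2 * h2

theorem cross_frame {t n : E3} (hn : ‖n‖ = 1) (h : inner ℝ t n = 0) (r k : ℝ) :
    cross3 n (r • (k • t + cross3 t n)) = r • (t - k • cross3 t n) := by
  have h1 := unit_c hn
  have h2 := orth_c h
  ext i
  fin_cases i
  · simp only [Fin.zero_eta, Fin.mk_one, Fin.reduceFinMk, c3_0, c3_1, c3_2, PiLp.smul_apply,
      PiLp.add_apply, PiLp.sub_apply, smul_eq_mul]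
    linear_combination r * t 0 * h1 - r * n 0 * h2
  · simp only [Fin.zero_eta, Fin.mk_one, Fin.reduceFinMk, c3_0, c3_1, c3_2, PiLp.smul_apply,
      PiLp.add_apply, PiLp.sub_apply, smul_eq_mul]
    linear_combination r * t 1 * h1 - r * n 1 * h2
  · simp only [Fin.zero_eta, Fin.mk_one, Fin.reduceFinMk, c3_0, c3_1, c3_2, PiLp.smul_apply,
      PiLp.add_apply, PiLp.sub_apply, smul_eq_mul]
    linear_combination r * t 2 * h1 - r * n 2 * h2

theorem norm_frame {t n : E3} (ht : ‖t‖ = 1) (hn : ‖n‖ = 1) (h : inner ℝ t n = 0) (k : ℝ) :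
    ‖k • t + cross3 t n‖ = √(1 + k ^ 2) := by
  have h1 := unit_c hn
  have h2 := orth_c h
  have h3 := unit_c ht
  rw [EuclideanSpace.norm_eq]
  congr 1
  simp only [Fin.sum_univ_three, c3_0, c3_1, c3_2, PiLp.smul_apply,
      PiLp.add_apply, smul_eq_mul, Real.norm_eq_abs, sq_abs]
  linear_combination (k ^ 2 + n 0 ^ 2 + n 1 ^ 2 + n 2 ^ 2) * h3 + h1
    - (t 0 * n 0 + t 1 * n 1 + t 2 * n 2) * h2

theorem FrenetCurve.orth {I : Set ℝ} (hI : IsOpen I) (c : FrenetCurve I) {s : ℝ} (hs : s ∈ I) :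
    inner ℝ (c.T s) (c.N s) = 0 := by
  have hd := (c.frenet_T s hs).inner ℝ (c.frenet_T s hs)
  have he : (fun x => inner ℝ (c.T x) (c.T x)) =ᶠ[nhds s] fun _ => (1 : ℝ) := by
    filter_upwards [hI.mem_nhds hs] with x hx
    rw [real_inner_self_eq_norm_sq, c.unit_T x hx]; norm_num
  have h0 := hd.unique ((hasDerivAt_const s (1 : ℝ)).congr_of_eventuallyEq he)
  rw [real_inner_smul_left, real_inner_smul_right, real_inner_comm (c.T s) (c.N s)] at h0
  have hk := c.κ_pos s hs
  have h1 : c.κ s * inner ℝ (c.T s) (c.N s) = 0 := by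
    linarith
  exact (mul_eq_zero.mp h1).resolve_left (ne_of_gt hk)

/-- For a Mannheim couple with constant `λ = l`, `l·κ·(1 + H²) = 1`, `H > 0` on
`I`, and `B_β (φ s) = N s`, the Frenet frame of `β` at corresponding points is
`T_β (φ s) = (H·T + B)/√(1 + H²)` and `N_β (φ s) = (T − H·B)/√(1 + H²)`. -/
theorem mannheim_partner_frame
    (I J : Set ℝ) (hI : IsOpen I) (hJ : IsOpen J)
    (a : FrenetCurve I) (b : FrenetCurve J) (M : MannheimCouple I J a b)
    (l : ℝ) (hlam : ∀ s ∈ I, M.lam s = l)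
    (hrel : ∀ s ∈ I, l * a.κ s * (1 + a.H s ^ 2) = 1)
    (hH : ∀ s ∈ I, 0 < a.H s)
    (hB : ∀ s ∈ I, b.B (M.φ s) = a.N s) :
    ∀ s ∈ I,
      b.T (M.φ s) = (Real.sqrt (1 + a.H s ^ 2))⁻¹ • (a.H s • a.T s + a.B s) ∧
      b.N (M.φ s) = (Real.sqrt (1 + a.H s ^ 2))⁻¹ • (a.T s - a.H s • a.B s) := by
  intro s hs
  have hoa := a.orth hI hs
  have hob := b.orth hJ (M.maps s hs)
  have hd1 := (b.deriv_α _ (M.maps s hs)).scomp s (M.deriv_φ s hs)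
  have hd2 := (a.deriv_α s hs).add ((a.frenet_N s hs).const_smul l)
  have he : (b.α ∘ M.φ) =ᶠ[nhds s] (a.α + l • a.N) := by
    filter_upwards [hI.mem_nhds hs] with x hx
    simp [M.couple x hx, hlam x hx]
  have hv := hd1.unique (hd2.congr_of_eventuallyEq he)
  have hk := a.κ_pos s hs
  have hτ : a.τ s = a.H s * a.κ s := by
    simp only [FrenetCurve.H]; field_simp
  have hr := hrel s hs
  have hh := hH s hs
  have hB' := hB s hs
  have hbB := b.B_def _ (M.maps s hs)
  have haB := a.B_def s hs
  have hdp := M.dφ_pos s hs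
  generalize a.H s = k at *
  have hv2 : M.dφ s • b.T (M.φ s) = (l * a.κ s * k) • (k • a.T s + a.B s) := by
    rw [hv, hτ]
    ext i
    simp only [PiLp.smul_apply, PiLp.add_apply, smul_eq_mul]
    linear_combination (-a.T s i) * hr
  have hlk : 0 < l * a.κ s := by
    by_contra hc
    nlinarith [mul_nonneg (neg_nonneg.2 (not_lt.1 hc)) (by positivity : 0 ≤ 1 + k ^ 2)]
  have hnf := norm_frame (a.unit_T s hs) (a.unit_N s hs) hoa k
  rw [← haB] at hnf
  have hsq : 0 < √(1 + k ^ 2) := Real.sqrt_pos.2 (by positivity)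
  have hn := congrArg norm hv2
  rw [norm_smul, norm_smul, hnf, b.unit_T _ (M.maps s hs), Real.norm_of_nonneg hdp.le,
    Real.norm_of_nonneg (by positivity), mul_one] at hn
  have hT : b.T (M.φ s) = (√(1 + k ^ 2))⁻¹ • (k • a.T s + a.B s) := by
    apply smul_right_injective E3 hdp.ne'
    simp only
    rw [hv2, smul_smul, hn, mul_assoc (l * a.κ s * k), mul_inv_cancel₀ hsq.ne', mul_one]
  refine ⟨hT, ?_⟩
  have hN := cross_cross_self (b.unit_T _ (M.maps s hs)) hob
  rw [← hN, ← hbB, hB', hT, haB]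
  exact cross_frame (a.unit_N s hs) hoa _ _
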